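/- The function η(x) = sup_{j ≥ 1} ψ_j(x) is continuous on ℝ, and the function x ↦ η(x) − k₁x is nondecreasing on ℝ. -/

import Mathlib

open Real Filter Set

/-- x-coordinate of the intersection of the lines y = k*x and y = -k₂/2 + k₁(x+1/2). -/
noncomputable def xstar (k1 k2 ks : ℝ) : ℝ := (k1 - k2) / (2 * (ks - k1))

/-- y-coordinate: y* = k* x*. -/
noncomputable def ystar (k1 k2 ks : ℝ) : ℝ := ks * xstar k1 k2 ks

/-- The slope k⁺ = (y* + k₂)/(x* + 1). -/
noncomputable def kplus (k1 k2 ks : ℝ) : ℝ :=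
  (ystar k1 k2 ks + k2) / (xstar k1 k2 ks + 1)

/-- The function ψ: equal to k₂x outside (-1, -1/2), and the min of the two lines inside. -/
noncomputable def psi (k1 k2 ks : ℝ) (x : ℝ) : ℝ :=
  if x ∈ Set.Ioo (-1 : ℝ) (-(1 / 2) : ℝ) then
    min (-k2 + kplus k1 k2 ks * (x + 1)) (-k2 / 2 + k1 * (x + 1 / 2))
  else k2 * x

/-- The rescaled functions ψ_j(x) = 2^(-j) ψ(2^j x). -/
noncomputable def psij (k1 k2 ks : ℝ) (j : ℕ) (x : ℝ) : ℝ :=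
  (2 : ℝ) ^ (-(j : ℤ)) * psi k1 k2 ks ((2 : ℝ) ^ j * x)

/-- η(x) = sup_{j ≥ 1} ψ_j(x). -/
noncomputable def eta (k1 k2 ks : ℝ) (x : ℝ) : ℝ :=
  ⨆ j : {j : ℕ // 1 ≤ j}, psij k1 k2 ks j x

/-- h(x) = η(x - d). -/
noncomputable def hfun (k1 k2 ks d : ℝ) (x : ℝ) : ℝ := eta k1 k2 ks (x - d)

/-- f(x) = k₀ (x - d). -/
noncomputable def ffun (k0 d : ℝ) (x : ℝ) : ℝ := k0 * (x - d)

/-- g(x) = f(-x) - h(-x). -/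
noncomputable def gfun (k0 k1 k2 ks d : ℝ) (x : ℝ) : ℝ :=
  ffun k0 d (-x) - hfun k1 k2 ks d (-x)

lemma lt_kplus {k1 k2 ks : ℝ} (hks1 : (k1 + k2) / 2 < ks) (hks2 : ks < k2) :
    k2 < kplus k1 k2 ks := by
  have hden : 0 < 2 * (ks - k1) := by linarith
  have hx1 : -1 < xstar k1 k2 ks := by
    rw [xstar, lt_div_iff₀ hden]; linarith
  have hx0 : xstar k1 k2 ks < 0 := by
    rw [xstar, div_lt_iff₀ hden]; linarith
  rw [kplus, ystar, lt_div_iff₀ (by linarith)]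
  nlinarith

/-- `ψ` is the maximum of `k₂x` and the minimum of the two lines, on all of `ℝ`. -/
lemma psi_eq_max {k1 k2 ks : ℝ} (hk12 : k1 < k2) (hk : k2 < kplus k1 k2 ks) (x : ℝ) :
    psi k1 k2 ks x =
      max (k2 * x) (min (-k2 + kplus k1 k2 ks * (x + 1)) (-k2 / 2 + k1 * (x + 1 / 2))) := by
  unfold psi
  split_ifs with h
  · obtain ⟨h1, h2⟩ := h
    refine (max_eq_right (le_min ?_ ?_)).symm <;> nlinarith
  · refine (max_eq_left ?_).symm
    rcases le_or_gt x (-1) with h1 | h1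
    · exact min_le_of_left_le (by nlinarith)
    · have h2 : -(1 / 2) ≤ x := not_lt.1 fun h2 => h ⟨h1, h2⟩
      exact min_le_of_right_le (by nlinarith)

lemma psi_sub_mem_Icc {k1 k2 ks x y : ℝ} (hk12 : k1 < k2) (hk : k2 < kplus k1 k2 ks)
    (hxy : x ≤ y) :
    psi k1 k2 ks y - psi k1 k2 ks x ∈ Icc (k1 * (y - x)) (kplus k1 k2 ks * (y - x)) := by
  rw [psi_eq_max hk12 hk, psi_eq_max hk12 hk]
  set K := kplus k1 k2 ks
  have h1 : k1 * (y - x) ≤ k2 * (y - x) := by gcongr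
  have h2 : k2 * (y - x) ≤ K * (y - x) := by gcongr
  constructor
  · rw [le_sub_iff_add_le', ← max_add_add_right, ← min_add_add_right]
    refine max_le_max ?_ (min_le_min ?_ ?_) <;> linarith
  · rw [sub_le_iff_le_add', ← max_add_add_right, ← min_add_add_right]
    refine max_le_max ?_ (min_le_min ?_ ?_) <;> linarith

lemma psij_sub_mem_Icc {k1 k2 ks x y : ℝ} (hk12 : k1 < k2) (hk : k2 < kplus k1 k2 ks)
    (j : ℕ) (hxy : x ≤ y) :
    psij k1 k2 ks j y - psij k1 k2 ks j x ∈ Icc (k1 * (y - x)) (kplus k1 k2 ks * (y - x)) := by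
  have hp : (0 : ℝ) < 2 ^ j := by positivity
  obtain ⟨h1, h2⟩ := psi_sub_mem_Icc hk12 hk (mul_le_mul_of_nonneg_left hxy hp.le)
  rw [psij, psij, zpow_neg, zpow_natCast, ← mul_sub, inv_mul_eq_div]
  constructor
  · rw [le_div_iff₀ hp]; linarith
  · rw [div_le_iff₀ hp]; linarith

lemma psij_zero (k1 k2 ks : ℝ) (j : ℕ) : psij k1 k2 ks j 0 = 0 := by
  simp [psij, psi]

lemma bddAbove_range_psij {k1 k2 ks : ℝ} (hk1 : 0 < k1) (hk12 : k1 < k2)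
    (hk : k2 < kplus k1 k2 ks) (x : ℝ) :
    BddAbove (range fun j : {j : ℕ // 1 ≤ j} => psij k1 k2 ks j x) := by
  refine ⟨kplus k1 k2 ks * |x|, ?_⟩
  rintro _ ⟨j, rfl⟩
  have hx := (psij_sub_mem_Icc hk12 hk j (le_abs_self x)).1
  have hx0 := (psij_sub_mem_Icc hk12 hk j (abs_nonneg x)).2
  have := mul_nonneg hk1.le (sub_nonneg.2 (le_abs_self x))
  rw [psij_zero] at hx0
  dsimp only
  linarith

lemma eta_sub_mem_Icc {k1 k2 ks x y : ℝ} (hk1 : 0 < k1) (hk12 : k1 < k2)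
    (hk : k2 < kplus k1 k2 ks) (hxy : x ≤ y) :
    eta k1 k2 ks y - eta k1 k2 ks x ∈ Icc (k1 * (y - x)) (kplus k1 k2 ks * (y - x)) := by
  have : Nonempty {j : ℕ // 1 ≤ j} := ⟨⟨1, le_rfl⟩⟩
  constructor
  · rw [le_sub_comm]
    refine ciSup_le fun j => ?_
    have h1 := (psij_sub_mem_Icc hk12 hk j hxy).1
    have h2 : psij k1 k2 ks j y ≤ eta k1 k2 ks y :=
      le_ciSup (bddAbove_range_psij hk1 hk12 hk y) j
    linarith
  · rw [sub_le_iff_le_add]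
    refine ciSup_le fun j => ?_
    have h1 := (psij_sub_mem_Icc hk12 hk j hxy).2
    have h2 : psij k1 k2 ks j x ≤ eta k1 k2 ks x :=
      le_ciSup (bddAbove_range_psij hk1 hk12 hk x) j
    linarith

/-- η is continuous and x ↦ η(x) − k₁x is nondecreasing. -/
theorem stmt_3 (k1 k2 ks : ℝ) (hk1 : 0 < k1) (hk12 : k1 < k2)
    (hks1 : (k1 + k2) / 2 < ks) (hks2 : ks < k2) :
    Continuous (eta k1 k2 ks) ∧ Monotone (fun x => eta k1 k2 ks x - k1 * x) := by
  have hk := lt_kplus hks1 hks2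
  refine ⟨(LipschitzWith.of_le_add_mul (kplus k1 k2 ks).toNNReal fun x y => ?_).continuous,
    fun x y hxy => ?_⟩
  · rw [Real.coe_toNNReal _ (by linarith), Real.dist_eq]
    rcases le_total x y with h | h
    · have h1 := (eta_sub_mem_Icc hk1 hk12 hk h).1
      have h2 : 0 ≤ k1 * (y - x) := mul_nonneg hk1.le (sub_nonneg.2 h)
      have h3 : 0 ≤ kplus k1 k2 ks * |x - y| := mul_nonneg (by linarith) (abs_nonneg _)
      linarith
    · rw [abs_of_nonneg (sub_nonneg.2 h)]
      linarith [(eta_sub_mem_Icc hk1 hk12 hk h).2]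
  · have h1 := (eta_sub_mem_Icc hk1 hk12 hk hxy).1
    dsimp only
    linarith
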